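/- (Main Adams trace theorem) Let μ be a nonnegative Radon measure on ℝⁿ, p₁,…,p_m ∈ (1,∞), 1/p = ∑_{j=1}^m 1/p_j. Suppose 1 < p ≤ p₀ < n/α and 0 < β < α < mn. Set θ = (n−βp₀)/(n−αp₀), q = θp, q₀ = θp₀. Then ‖I_α(f⃗)‖_{M_μ^{q,q₀}} ≲ ‖μ‖_{n−βp}^{1/q} ‖f⃗‖_{M^{P⃗,p₀}}. -/

import Mathlib

open MeasureTheory ENNReal

noncomputable section

variable {n : ℕ}

/-- Axis-parallel cube with lower corner `a` and side length `r` (half-open). -/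
def cube (a : Fin n → ℝ) (r : ℝ) : Set (Fin n → ℝ) :=
  {y | ∀ i, a i ≤ y i ∧ y i < a i + r}

/-- The dyadic cube `2^{-k}(m + [0,1)^n)`. -/
def dyadicCube (k : ℤ) (mv : Fin n → ℤ) : Set (Fin n → ℝ) :=
  cube (fun i => (mv i : ℝ) * (2 : ℝ) ^ (-k)) ((2 : ℝ) ^ (-k))

/-- The concentric triple `3Q` of the cube with corner `a` and side `r`. -/
def tripleCube (a : Fin n → ℝ) (r : ℝ) : Set (Fin n → ℝ) :=
  cube (fun i => a i - r) (3 * r)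

/-- The Morrey norm `‖f‖_{M^{p,p₀}}`. -/
def morreyNorm (p p0 : ℝ) (f : (Fin n → ℝ) → ℝ) : ℝ≥0∞ :=
  ⨆ (a : Fin n → ℝ) (r : ℝ) (_ : 0 < r),
    volume (cube a r) ^ (1 / p0 - 1 / p) *
      (∫⁻ x in cube a r, ENNReal.ofReal |f x| ^ p) ^ (1 / p)

/-- The product Morrey norm `‖f⃗‖_{M^{P⃗,p₀}}`. -/
def prodMorreyNorm {m : ℕ} (P : Fin m → ℝ) (p p0 : ℝ)
    (f : Fin m → (Fin n → ℝ) → ℝ) : ℝ≥0∞ :=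
  ⨆ (a : Fin n → ℝ) (r : ℝ) (_ : 0 < r),
    volume (cube a r) ^ (1 / p0 - 1 / p) *
      ∏ j, (∫⁻ x in cube a r, ENNReal.ofReal |f j x| ^ P j) ^ (1 / P j)

/-- The Radon–Morrey norm `‖g‖_{M_μ^{q,q₀}}`. -/
def radonMorreyNorm (μ : Measure (Fin n → ℝ)) (q q0 : ℝ)
    (g : (Fin n → ℝ) → ℝ≥0∞) : ℝ≥0∞ :=
  ⨆ (a : Fin n → ℝ) (r : ℝ) (_ : 0 < r),
    volume (cube a r) ^ (1 / q0 - 1 / q) * (∫⁻ x in cube a r, g x ^ q ∂μ) ^ (1 / q)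

/-- The growth norm `‖μ‖_β := sup_Q μ(Q)/ℓ_Q^β`. -/
def measureGrowthNorm (μ : Measure (Fin n → ℝ)) (β : ℝ) : ℝ≥0∞ :=
  ⨆ (a : Fin n → ℝ) (r : ℝ) (_ : 0 < r), μ (cube a r) / ENNReal.ofReal r ^ β

/-- The `m`-sublinear fractional maximal operator `𝔐_α`. -/
def fracMaximal {m : ℕ} (α : ℝ) (f : Fin m → (Fin n → ℝ) → ℝ)
    (x : Fin n → ℝ) : ℝ≥0∞ :=
  ⨆ (a : Fin n → ℝ) (r : ℝ) (_ : 0 < r) (_ : x ∈ cube a r),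
    ENNReal.ofReal r ^ (α - (m : ℝ) * n) *
      ∏ j, ∫⁻ y in cube a r, ENNReal.ofReal |f j y|

/-- The dyadic `m`-sublinear fractional maximal operator `𝔐_α^𝒟`. -/
def dyadicFracMaximal {m : ℕ} (α : ℝ) (f : Fin m → (Fin n → ℝ) → ℝ)
    (x : Fin n → ℝ) : ℝ≥0∞ :=
  ⨆ (k : ℤ) (mv : Fin n → ℤ) (_ : x ∈ dyadicCube k mv),
    ENNReal.ofReal ((2 : ℝ) ^ (-k)) ^ (α - (m : ℝ) * n) *
      ∏ j, ∫⁻ y in dyadicCube k mv, ENNReal.ofReal |f j y|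

/-- The dyadic `m`-linear fractional integral operator `ℑ_α^𝒟`. -/
def dyadicFracIntegral {m : ℕ} (α : ℝ) (f : Fin m → (Fin n → ℝ) → ℝ)
    (x : Fin n → ℝ) : ℝ≥0∞ :=
  ∑' qk : ℤ × (Fin n → ℤ),
    (dyadicCube qk.1 qk.2).indicator
      (fun _ => ENNReal.ofReal ((2 : ℝ) ^ (-qk.1)) ^ (α - (m : ℝ) * n) *
        ∏ j, ∫⁻ y in dyadicCube qk.1 qk.2, ENNReal.ofReal |f j y|) x

/-- The `m`-linear fractional integral operator `ℑ_α` (with Euclidean distances). -/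
def fracIntegral {m : ℕ} (α : ℝ) (f : Fin m → (Fin n → ℝ) → ℝ)
    (x : Fin n → ℝ) : ℝ≥0∞ :=
  ∫⁻ y : Fin m → Fin n → ℝ,
    (∏ j, ENNReal.ofReal |f j (y j)|) /
      ENNReal.ofReal ((∑ j, Real.sqrt (∑ i, (x i - y j i) ^ 2)) ^ ((m : ℝ) * n - α))


lemma two_rpow_ne_zero (x : ℝ) : (2:ℝ≥0∞) ^ x ≠ 0 := by
  simp [ENNReal.rpow_eq_zero_iff]

lemma two_rpow_ne_top (x : ℝ) : (2:ℝ≥0∞) ^ x ≠ ∞ := by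
  simp [ENNReal.rpow_eq_top_iff]

lemma two_rpow_add (x y : ℝ) : (2:ℝ≥0∞) ^ (x + y) = 2 ^ x * 2 ^ y :=
  ENNReal.rpow_add _ _ (by simp) (by simp)

lemma two_rpow_le {x y : ℝ} (h : x ≤ y) : (2:ℝ≥0∞) ^ x ≤ 2 ^ y :=
  ENNReal.rpow_le_rpow_of_exponent_le (by norm_num) h

lemma exists_two_rpow {v : ℝ≥0∞} (h0 : v ≠ 0) (h1 : v ≠ ∞) :
    ∃ k : ℤ, (2:ℝ≥0∞) ^ (k:ℝ) ≤ v ∧ v < 2 ^ ((k:ℝ) + 1) := by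
  obtain ⟨k, hk⟩ := ENNReal.exists_mem_Ico_zpow h0 h1 (y := 2) (by norm_num) (by simp)
  refine ⟨k, ?_, ?_⟩
  · rw [ENNReal.rpow_intCast]; exact hk.1
  · have := hk.2
    rw [← ENNReal.rpow_intCast] at this
    push_cast at this
    exact this

lemma geo_down (η : ℝ) (hη : 0 < η) : ∃ C : ℝ≥0∞, C ≠ ∞ ∧ ∀ K : ℤ,
    ∑' k : ℤ, (if k ≤ K then (2:ℝ≥0∞) ^ ((k:ℝ) * η) else 0) ≤ C * 2 ^ ((K:ℝ) * η) := by
  refine ⟨(1 - (2:ℝ≥0∞) ^ (-η))⁻¹, ?_, ?_⟩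
  · rw [ENNReal.inv_ne_top]
    have : (2:ℝ≥0∞) ^ (-η) < 1 := ENNReal.rpow_lt_one_of_one_lt_of_neg (by norm_num) (by linarith)
    exact (tsub_pos_of_lt this).ne'
  · intro K
    have hinj : Function.Injective (fun j : ℕ => K - (j:ℤ)) := by
      intro a b h; simp at h; exact h
    rw [← hinj.tsum_eq]
    · rw [← ENNReal.tsum_geometric, ← ENNReal.tsum_mul_right]
      apply le_of_eq
      congr 1
      ext j
      rw [if_pos (by omega), ← ENNReal.rpow_natCast, ← ENNReal.rpow_mul, ← two_rpow_add]
      congr 1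
      push_cast
      ring
    · intro k hk
      simp only [Function.mem_support, ne_eq, ite_eq_right_iff, not_forall] at hk
      obtain ⟨hk, _⟩ := hk
      exact ⟨(K - k).toNat, by simp; omega⟩

lemma geo_up (η : ℝ) (hη : 0 < η) : ∃ C : ℝ≥0∞, C ≠ ∞ ∧ ∀ K : ℤ,
    ∑' k : ℤ, (if K < k then (2:ℝ≥0∞) ^ (-((k:ℝ) * η)) else 0) ≤ C * 2 ^ (-((K:ℝ) * η)) := by
  obtain ⟨C, hC, h⟩ := geo_down η hη
  refine ⟨C, hC, fun K => ?_⟩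
  rw [← (Equiv.neg ℤ).tsum_eq]
  calc _ = ∑' k : ℤ, (if k ≤ -K - 1 then (2:ℝ≥0∞) ^ ((k:ℝ) * η) else 0) := by
        congr 1
        ext k
        simp only [Equiv.neg_apply]
        have : K < -k ↔ k ≤ -K - 1 := by omega
        simp [this]
    _ ≤ _ := h _
    _ ≤ _ := by
        refine mul_le_mul_right (two_rpow_le ?_) C
        push_cast
        nlinarith

lemma geo_lt (η : ℝ) (hη : 0 < η) : ∃ C : ℝ≥0∞, C ≠ ∞ ∧ ∀ v : ℝ≥0∞,
    ∑' k : ℤ, (if (2:ℝ≥0∞) ^ (k:ℝ) < v then (2:ℝ≥0∞) ^ ((k:ℝ) * η) else 0) ≤ C * v ^ η := by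
  obtain ⟨C, hC, h⟩ := geo_down η hη
  refine ⟨C + 1, by simp [hC], fun v => ?_⟩
  rcases eq_or_ne v 0 with rfl | h0
  · simp
  rcases eq_or_ne v ∞ with rfl | h1
  · rw [ENNReal.top_rpow_of_pos hη, ENNReal.mul_top (by simp)]; exact le_top
  obtain ⟨K, hK1, hK2⟩ := exists_two_rpow h0 h1
  calc _ ≤ ∑' k : ℤ, (if k ≤ K then (2:ℝ≥0∞) ^ ((k:ℝ) * η) else 0) := by
        apply ENNReal.tsum_le_tsum
        intro k
        split_ifs with ha hb
        · exact le_rfl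
        · exfalso
          have : (2:ℝ≥0∞) ^ ((K:ℝ) + 1) ≤ 2 ^ (k:ℝ) := by
            apply two_rpow_le
            exact_mod_cast (by omega : K + 1 ≤ k)
          exact absurd (hK2.trans_le this) (not_lt.2 ha.le)
        · simp
        · simp
    _ ≤ C * 2 ^ ((K:ℝ) * η) := h K
    _ ≤ (C + 1) * v ^ η := by
        rw [ENNReal.rpow_mul]
        gcongr
        simp

lemma hedberg (α β δ : ℝ) (h1 : β < α) (h2 : α < δ) : ∃ C : ℝ≥0∞, C ≠ ∞ ∧
    ∀ (A M : ℝ≥0∞) (b : ℤ → ℝ≥0∞), (∀ k, b k ≤ 2 ^ (-((k:ℝ) * β)) * A) →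
      (∀ k, b k ≤ 2 ^ (-((k:ℝ) * δ)) * M) →
      ∑' k : ℤ, (2:ℝ≥0∞) ^ ((k:ℝ) * α) * b k ≤
        C * (A ^ ((δ - α) / (δ - β)) * M ^ (1 - (δ - α) / (δ - β))) := by
  obtain ⟨C1, hC1, g1⟩ := geo_down (α - β) (by linarith)
  obtain ⟨C2, hC2, g2⟩ := geo_up (δ - α) (by linarith)
  have hs : 0 < (δ - α) / (δ - β) := div_pos (by linarith) (by linarith)
  have hs1 : 0 < 1 - (δ - α) / (δ - β) := by
    rw [sub_pos, div_lt_one (by linarith)]; linarith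
  refine ⟨C1 + C2 * 2 ^ (δ - α) + 1, by simp [hC1, hC2, ENNReal.mul_eq_top, two_rpow_ne_top], ?_⟩
  intro A M b hA hM
  rcases eq_or_ne A 0 with rfl | hA0
  · have : ∀ k, b k = 0 := fun k => by simpa using hA k
    simp [this]
  rcases eq_or_ne M 0 with rfl | hM0
  · have : ∀ k, b k = 0 := fun k => by simpa using hM k
    simp [this]
  rcases eq_or_ne A ∞ with rfl | hAt
  · rw [ENNReal.top_rpow_of_pos hs, ENNReal.top_mul, ENNReal.mul_top]
    · exact le_top
    · simp
    · simp only [ne_eq, ENNReal.rpow_eq_zero_iff, hM0, false_and, false_or, not_and, not_lt]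
      exact fun _ => hs1.le
  rcases eq_or_ne M ∞ with rfl | hMt
  · rw [ENNReal.top_rpow_of_pos hs1, ENNReal.mul_top, ENNReal.mul_top]
    · exact le_top
    · simp
    · simp only [ne_eq, ENNReal.rpow_eq_zero_iff, hA0, false_and, false_or, not_and, not_lt]
      exact fun _ => hs.le
  have hv0 : (M / A) ^ (1 / (δ - β)) ≠ 0 := by
    simp [ENNReal.rpow_eq_zero_iff, ENNReal.div_eq_top, ENNReal.div_eq_zero_iff, hM0, hAt, hA0, hMt]
  have hvt : (M / A) ^ (1 / (δ - β)) ≠ ∞ := by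
    simp [ENNReal.rpow_eq_top_iff, ENNReal.div_eq_top, ENNReal.div_eq_zero_iff, hM0, hAt, hA0, hMt]
  obtain ⟨K, hK1, hK2⟩ := exists_two_rpow hv0 hvt
  have e1 : (2:ℝ≥0∞) ^ ((K:ℝ) * (α - β)) * A ≤
      A ^ ((δ - α) / (δ - β)) * M ^ (1 - (δ - α) / (δ - β)) := by
    calc _ ≤ ((M / A) ^ (1 / (δ - β))) ^ (α - β) * A := by
          rw [ENNReal.rpow_mul]; gcongr
      _ = M ^ (1 - (δ - α) / (δ - β)) * (A ^ (-(1 - (δ - α) / (δ - β))) * A ^ (1:ℝ)) := by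
          have e : (1 / (δ - β)) * (α - β) = 1 - (δ - α) / (δ - β) := by
            have : δ - β ≠ 0 := by linarith
            field_simp
            ring
          rw [← ENNReal.rpow_mul, e, ENNReal.div_rpow_of_nonneg _ _ hs1.le, div_eq_mul_inv,
            ← ENNReal.rpow_neg, mul_assoc, ENNReal.rpow_one]
      _ = _ := by
          rw [← ENNReal.rpow_add _ _ hA0 hAt, mul_comm]
          congr 2
          ring
  have e2 : (2:ℝ≥0∞) ^ (-((K:ℝ) * (δ - α))) * M ≤ 2 ^ (δ - α) *
      (A ^ ((δ - α) / (δ - β)) * M ^ (1 - (δ - α) / (δ - β))) := by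
    calc _ = 2 ^ (δ - α) * ((2 ^ ((K:ℝ) + 1)) ^ (-(δ - α)) * M) := by
          rw [← ENNReal.rpow_mul, ← mul_assoc, ← two_rpow_add]
          congr 2
          ring
      _ ≤ 2 ^ (δ - α) * (((M / A) ^ (1 / (δ - β))) ^ (-(δ - α)) * M) := by
          gcongr 2 ^ (δ - α) * (?_ * M)
          rw [ENNReal.rpow_neg, ENNReal.rpow_neg, ENNReal.inv_le_inv]
          exact ENNReal.rpow_le_rpow hK2.le (by linarith)
      _ = 2 ^ (δ - α) * (A ^ ((δ - α) / (δ - β)) * (M ^ (-((δ - α) / (δ - β))) * M ^ (1:ℝ))) := by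
          have e : (1 / (δ - β)) * (-(δ - α)) = -((δ - α) / (δ - β)) := by
            ring
          rw [← ENNReal.rpow_mul, e, ENNReal.rpow_neg, ENNReal.div_rpow_of_nonneg _ _ hs.le,
            ENNReal.inv_div (Or.inl _) (Or.inl _), div_eq_mul_inv,
            ← ENNReal.rpow_neg, mul_assoc, ENNReal.rpow_one]
          · simp [ENNReal.rpow_eq_top_iff, hAt, hA0]
          · simp [ENNReal.rpow_eq_zero_iff, hAt, hA0]
      _ = _ := by
          rw [← ENNReal.rpow_add _ _ hM0 hMt]
          congr 3
          ring
  set X := A ^ ((δ - α) / (δ - β)) * M ^ (1 - (δ - α) / (δ - β))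
  calc _ ≤ ∑' k : ℤ, ((if k ≤ K then (2:ℝ≥0∞) ^ ((k:ℝ) * (α - β)) else 0) * A +
        (if K < k then (2:ℝ≥0∞) ^ (-((k:ℝ) * (δ - α))) else 0) * M) := by
        apply ENNReal.tsum_le_tsum
        intro k
        rcases le_or_gt k K with h | h
        · rw [if_pos h, if_neg (by omega), zero_mul, add_zero]
          calc _ ≤ (2:ℝ≥0∞) ^ ((k:ℝ) * α) * (2 ^ (-((k:ℝ) * β)) * A) := by gcongr; exact hA k
            _ = _ := by
              rw [← mul_assoc, ← two_rpow_add]; congr 2; ring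
        · rw [if_neg (by omega), if_pos h, zero_mul, zero_add]
          calc _ ≤ (2:ℝ≥0∞) ^ ((k:ℝ) * α) * (2 ^ (-((k:ℝ) * δ)) * M) := by gcongr; exact hM k
            _ = _ := by
              rw [← mul_assoc, ← two_rpow_add]; congr 2; ring
    _ ≤ (C1 * 2 ^ ((K:ℝ) * (α - β))) * A + (C2 * 2 ^ (-((K:ℝ) * (δ - α)))) * M := by
        rw [ENNReal.tsum_add, ENNReal.tsum_mul_right, ENNReal.tsum_mul_right]
        gcongr
        · exact g1 K
        · exact g2 K
    _ ≤ C1 * X + C2 * (2 ^ (δ - α) * X) := by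
        rw [mul_assoc, mul_assoc]
        gcongr
    _ ≤ _ := by
        rw [add_mul, add_mul, mul_assoc]
        exact le_self_add

lemma cube_eq_pi (a : Fin n → ℝ) (r : ℝ) :
    cube a r = Set.pi Set.univ (fun i => Set.Ico (a i) (a i + r)) := by
  ext y; simp [cube, Set.mem_pi]

lemma measurableSet_cube (a : Fin n → ℝ) (r : ℝ) : MeasurableSet (cube a r) := by
  rw [cube_eq_pi]
  exact MeasurableSet.univ_pi (fun i => measurableSet_Ico)

lemma volume_cube (a : Fin n → ℝ) (r : ℝ) :
    volume (cube a r) = ENNReal.ofReal r ^ (n:ℝ) := by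
  rw [cube_eq_pi, Real.volume_pi_Ico]
  simp

lemma closedBall_subset_cube (x : Fin n → ℝ) {r : ℝ} (hr : 0 < r) :
    Metric.closedBall x r ⊆ cube (fun i => x i - r) (3 * r) := by
  intro y hy i
  rw [Metric.mem_closedBall] at hy
  have := (dist_le_pi_dist y x i).trans hy
  rw [Real.dist_eq, abs_le] at this
  constructor <;> linarith

lemma ofReal_rpow_ne_zero {r : ℝ} (hr : 0 < r) (x : ℝ) : ENNReal.ofReal r ^ x ≠ 0 := by
  simp [ENNReal.rpow_eq_zero_iff, hr]

lemma ofReal_rpow_ne_top {r : ℝ} (hr : 0 < r) (x : ℝ) : ENNReal.ofReal r ^ x ≠ ∞ := by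
  simp [ENNReal.rpow_eq_top_iff, hr]

lemma ofReal_rpow_add {r : ℝ} (hr : 0 < r) (x y : ℝ) :
    ENNReal.ofReal r ^ (x + y) = ENNReal.ofReal r ^ x * ENNReal.ofReal r ^ y :=
  ENNReal.rpow_add _ _ (by simpa using hr) (by simp)

lemma ofReal_mul_rpow {c r : ℝ} (hc : 0 < c) (hr : 0 < r) (x : ℝ) :
    ENNReal.ofReal (c * r) ^ x = ENNReal.ofReal c ^ x * ENNReal.ofReal r ^ x := by
  rw [ENNReal.ofReal_mul hc.le]
  exact ENNReal.mul_rpow_of_ne_top (by simp) (by simp) _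

/-- Vitali-type weak estimate. -/
lemma weak_est (s : ℝ) (hs : 0 ≤ s) (D : ℝ≥0∞) (μ : Measure (Fin n → ℝ))
    (hD : ∀ a r, 0 < r → μ (cube a r) ≤ D * ENNReal.ofReal r ^ ((n:ℝ) - s))
    (F : (Fin n → ℝ) → ℝ≥0∞) (R : ℝ) (l : ℝ≥0∞) :
    ∃ G : (Fin n → ℝ) → ℝ≥0∞, Measurable G ∧
      (∀ x r, 0 < r → r ≤ R →
        l * ENNReal.ofReal r ^ (n:ℝ) ≤ ∫⁻ y in Metric.closedBall x r, F y →
          ENNReal.ofReal r ^ s ≤ G x) ∧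
      l * ∫⁻ x, G x ∂μ ≤
        (ENNReal.ofReal 2 ^ s * ENNReal.ofReal 9 ^ ((n:ℝ) - s)) * D * ∫⁻ y, F y := by
  set t : Set ((Fin n → ℝ) × ℝ) := {z | 0 < z.2 ∧ z.2 ≤ R ∧
    l * ENNReal.ofReal z.2 ^ (n:ℝ) ≤ ∫⁻ y in Metric.closedBall z.1 z.2, F y} with ht
  obtain ⟨u, hut, hdisj, hcov⟩ := Vitali.exists_disjoint_subfamily_covering_enlargement
    (fun z : (Fin n → ℝ) × ℝ => Metric.closedBall z.1 z.2) t (fun z => z.2) 2 (by norm_num)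
    (fun a ha => ha.1.le) R (fun a ha => ha.2.1)
    (fun a ha => ⟨a.1, Metric.mem_closedBall_self ha.1.le⟩)
  have hcount : u.Countable := hdisj.countable_of_nonempty_interior (fun i hi => by
    have : (Metric.ball i.1 i.2).Nonempty := Metric.nonempty_ball.2 (hut hi).1
    exact this.mono Metric.ball_subset_interior_closedBall)
  have : Countable u := hcount.to_subtype
  refine ⟨fun x => ∑' b : u, (Metric.closedBall b.1.1 (3 * b.1.2)).indicator
    (fun _ => ENNReal.ofReal (2 * b.1.2) ^ s) x, ?_, ?_, ?_⟩
  · refine Measurable.tsum fun b => ?_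
    exact measurable_const.indicator Metric.isClosed_closedBall.measurableSet
  · intro x r hr hrR hl
    obtain ⟨b, hb, hne, hle⟩ := hcov (x, r) ⟨hr, hrR, hl⟩
    have hx : x ∈ Metric.closedBall b.1 (3 * b.2) := by
      obtain ⟨z, hz1, hz2⟩ := hne
      simp only [Metric.mem_closedBall] at hz1 hz2 hle ⊢
      have := dist_triangle_left x b.1 z
      linarith
    refine le_trans ?_ (ENNReal.le_tsum (⟨b, hb⟩ : u))
    rw [Set.indicator_of_mem hx]
    gcongr
  · rw [lintegral_tsum]
    swap
    · intro b
      exact (measurable_const.indicator Metric.isClosed_closedBall.measurableSet).aemeasurable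
    rw [← ENNReal.tsum_mul_left]
    calc _ ≤ ∑' b : u, (ENNReal.ofReal 2 ^ s * ENNReal.ofReal 9 ^ ((n:ℝ) - s)) * D *
          ∫⁻ y in Metric.closedBall b.1.1 b.1.2, F y := by
          apply ENNReal.tsum_le_tsum
          intro b
          have hb := hut b.2
          have hb0 : 0 < b.1.2 := hb.1
          rw [lintegral_indicator Metric.isClosed_closedBall.measurableSet, lintegral_const,
            Measure.restrict_apply_univ]
          calc _ ≤ l * (ENNReal.ofReal (2 * b.1.2) ^ s *
                (D * ENNReal.ofReal (9 * b.1.2) ^ ((n:ℝ) - s))) := by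
                gcongr
                refine (measure_mono (closedBall_subset_cube _ (by positivity))).trans ?_
                refine (hD _ _ (by positivity)).trans (le_of_eq ?_)
                congr 3
                ring
            _ = (ENNReal.ofReal 2 ^ s * ENNReal.ofReal 9 ^ ((n:ℝ) - s)) * D *
                (l * ENNReal.ofReal b.1.2 ^ (n:ℝ)) := by
                rw [ofReal_mul_rpow (by norm_num) hb0, ofReal_mul_rpow (by norm_num) hb0,
                  show (n:ℝ) = s + (n - s) by ring, ofReal_rpow_add hb0]
                simp only [add_sub_cancel]
                ring
            _ ≤ _ := by
                gcongr
                exact hb.2.2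
      _ = (ENNReal.ofReal 2 ^ s * ENNReal.ofReal 9 ^ ((n:ℝ) - s)) * D *
          ∫⁻ y in ⋃ b : u, Metric.closedBall b.1.1 b.1.2, F y := by
          rw [ENNReal.tsum_mul_left, lintegral_iUnion
            (fun b => Metric.isClosed_closedBall.measurableSet)]
          intro b c hbc
          exact hdisj b.2 c.2 (fun h => hbc (Subtype.ext h))
      _ ≤ _ := by
          exact mul_le_mul_right (setLIntegral_le_lintegral _ _) _

lemma strong_est (s P : ℝ) (hs : 0 ≤ s) (hP : 1 < P) : ∃ C : ℝ≥0∞, C ≠ ∞ ∧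
    ∀ (D : ℝ≥0∞) (μ : Measure (Fin n → ℝ)),
    (∀ a r, 0 < r → μ (cube a r) ≤ D * ENNReal.ofReal r ^ ((n:ℝ) - s)) →
    ∀ (F : (Fin n → ℝ) → ℝ≥0∞), Measurable F → ∀ (R : ℝ),
    ∃ G : (Fin n → ℝ) → ℝ≥0∞, Measurable G ∧
      (∀ x r, 0 < r → r ≤ R →
        ENNReal.ofReal r ^ s * (ENNReal.ofReal r ^ (-(n:ℝ)) *
          ∫⁻ y in Metric.closedBall x r, F y) ^ P ≤ G x) ∧
      ∫⁻ x, G x ∂μ ≤ C * D * ∫⁻ y, F y ^ P := by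
  obtain ⟨C1, hC1, g1⟩ := geo_lt (P - 1) (by linarith)
  set C0 : ℝ≥0∞ := ENNReal.ofReal 2 ^ s * ENNReal.ofReal 9 ^ ((n:ℝ) - s) with hC0
  have hC0t : C0 ≠ ∞ := ENNReal.mul_ne_top (ofReal_rpow_ne_top (by norm_num) _)
    (ofReal_rpow_ne_top (by norm_num) _)
  set c : ℝ≥0∞ := ENNReal.ofReal 3 ^ (n:ℝ) + 1 with hc
  have hct : c ≠ ∞ := ENNReal.add_ne_top.2 ⟨ofReal_rpow_ne_top (by norm_num) _, by simp⟩
  have hc0 : c ≠ 0 := by simp [hc]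
  set c2 : ℝ≥0∞ := (c * 2) ^ P with hc2
  have hc2t : c2 ≠ ∞ := ENNReal.rpow_ne_top_of_nonneg (by linarith)
    (ENNReal.mul_ne_top hct (by simp))
  refine ⟨c2 * C0 * C1, ENNReal.mul_ne_top (ENNReal.mul_ne_top hc2t hC0t) hC1, ?_⟩
  intro D μ hD F hF R
  have hset : ∀ k : ℤ, MeasurableSet {y | (2:ℝ≥0∞) ^ (k:ℝ) < F y} :=
    fun k => measurableSet_lt measurable_const hF
  set Fk : ℤ → (Fin n → ℝ) → ℝ≥0∞ :=
    fun k => {y | (2:ℝ≥0∞) ^ (k:ℝ) < F y}.indicator F with hFk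
  choose G hGm hG1 hG2 using fun k : ℤ => weak_est s hs D μ hD (Fk k) R ((2:ℝ≥0∞) ^ (k:ℝ))
  refine ⟨fun x => ∑' k : ℤ, c2 * 2 ^ ((k:ℝ) * P) * G k x, ?_, ?_, ?_⟩
  · refine Measurable.tsum fun k => ?_
    exact (hGm k).const_mul _
  · intro x r hr hrR
    set v := ENNReal.ofReal r ^ (-(n:ℝ)) * ∫⁻ y in Metric.closedBall x r, F y with hv
    rw [mul_comm, ← ENNReal.le_div_iff_mul_le (Or.inl (ofReal_rpow_ne_zero hr _))
      (Or.inl (ofReal_rpow_ne_top hr _))]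
    refine le_of_forall_lt_imp_le_of_dense fun u hu => ?_
    rcases eq_or_ne u 0 with rfl | hu0
    · exact zero_le
    have hP0 : 0 < P := by linarith
    rw [← ENNReal.rpow_inv_lt_iff hP0] at hu
    have hwt : u ^ (P⁻¹) ≠ ∞ := hu.ne_top
    have hw0 : u ^ (P⁻¹) ≠ 0 := by
      simp only [ne_eq, ENNReal.rpow_eq_zero_iff, hu0, false_and, false_or, not_and, not_lt]
      exact fun _ => by positivity
    obtain ⟨k, hk1, hk2⟩ := exists_two_rpow (v := u ^ (P⁻¹) / c)
      (by simp [ENNReal.div_eq_zero_iff, hw0, hct]) (by simp [ENNReal.div_eq_top, hwt, hc0])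
    rw [ENNReal.le_div_iff_mul_le (Or.inl hc0) (Or.inl hct)] at hk1
    rw [ENNReal.div_lt_iff (Or.inl hc0) (Or.inl hct)] at hk2
    have hk3 : 2 ^ (k:ℝ) * c < v := hk1.trans_lt hu
    have hu2 : u ≤ c2 * 2 ^ ((k:ℝ) * P) := by
      calc u = (u ^ (P⁻¹)) ^ P := by
            rw [← ENNReal.rpow_mul, inv_mul_cancel₀ hP0.ne', ENNReal.rpow_one]
        _ ≤ (2 ^ ((k:ℝ) + 1) * c) ^ P := by gcongr
        _ = (c * 2 * 2 ^ (k:ℝ)) ^ P := by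
            rw [two_rpow_add, ENNReal.rpow_one]; ring_nf
        _ = _ := by
            rw [ENNReal.mul_rpow_of_nonneg _ _ hP0.le, ← ENNReal.rpow_mul]
    have hG : ENNReal.ofReal r ^ s ≤ G k x := by
      apply hG1 k x r hr hrR
      have h1 : 2 ^ (k:ℝ) * c * ENNReal.ofReal r ^ (n:ℝ) ≤
          ∫⁻ y in Metric.closedBall x r, F y := by
        calc _ ≤ v * ENNReal.ofReal r ^ (n:ℝ) := by gcongr
          _ = (ENNReal.ofReal r ^ (-(n:ℝ)) * ENNReal.ofReal r ^ (n:ℝ)) *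
              ∫⁻ y in Metric.closedBall x r, F y := by rw [hv]; ring
          _ = _ := by
              rw [← ofReal_rpow_add hr]; simp
      have h2 : ∫⁻ y in Metric.closedBall x r, F y ≤
          2 ^ (k:ℝ) * (ENNReal.ofReal 3 ^ (n:ℝ) * ENNReal.ofReal r ^ (n:ℝ)) +
            ∫⁻ y in Metric.closedBall x r, Fk k y := by
        calc _ ≤ ∫⁻ y in Metric.closedBall x r, (2 ^ (k:ℝ) + Fk k y) := by
              apply lintegral_mono
              intro y
              simp only [hFk, Set.indicator_apply, Set.mem_ofPred_eq]
              split_ifs with h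
              · exact le_add_self
              · simpa using h
          _ = 2 ^ (k:ℝ) * volume (Metric.closedBall x r) +
                ∫⁻ y in Metric.closedBall x r, Fk k y := by
              rw [lintegral_add_left measurable_const, lintegral_const,
                Measure.restrict_apply_univ]
          _ ≤ _ := by
              gcongr
              refine (measure_mono (closedBall_subset_cube x hr)).trans ?_
              rw [volume_cube, ofReal_mul_rpow (by norm_num) hr]
      have h3 := h1.trans h2
      rw [hc, mul_add, add_mul, mul_one, ← mul_assoc] at h3
      refine (ENNReal.add_le_add_iff_left ?_).1 h3
      exact ENNReal.mul_ne_top (ENNReal.mul_ne_top (two_rpow_ne_top _)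
        (ofReal_rpow_ne_top (by norm_num) _)) (ofReal_rpow_ne_top hr _)
    rw [ENNReal.le_div_iff_mul_le (Or.inl (ofReal_rpow_ne_zero hr _))
      (Or.inl (ofReal_rpow_ne_top hr _))]
    calc _ ≤ c2 * 2 ^ ((k:ℝ) * P) * G k x := by gcongr
      _ ≤ _ := ENNReal.le_tsum (f := fun k : ℤ => c2 * 2 ^ ((k:ℝ) * P) * G k x) k
  · rw [lintegral_tsum (fun k => ((hGm k).const_mul _).aemeasurable)]
    calc _ ≤ ∑' k : ℤ, c2 * C0 * D * ∫⁻ y, 2 ^ ((k:ℝ) * (P - 1)) * Fk k y := by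
          apply ENNReal.tsum_le_tsum
          intro k
          rw [lintegral_const_mul _ (hGm k), lintegral_const_mul _ (hF.indicator (hset k))]
          calc _ = c2 * 2 ^ ((k:ℝ) * (P - 1)) * (2 ^ (k:ℝ) * ∫⁻ x, G k x ∂μ) := by
                rw [show (k:ℝ) * P = k * (P - 1) + k by ring, two_rpow_add]
                ring
            _ ≤ c2 * 2 ^ ((k:ℝ) * (P - 1)) * (C0 * D * ∫⁻ y, Fk k y) := by
                exact mul_le_mul_right (hG2 k) _
            _ = _ := by ring
      _ = c2 * C0 * D * ∫⁻ y, ∑' k : ℤ, 2 ^ ((k:ℝ) * (P - 1)) * Fk k y := by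
          rw [ENNReal.tsum_mul_left, lintegral_tsum]
          exact fun k => ((hF.indicator (hset k)).const_mul _).aemeasurable
      _ ≤ c2 * C0 * D * ∫⁻ y, C1 * F y ^ P := by
          gcongr with y
          calc _ = (∑' k : ℤ, (if (2:ℝ≥0∞) ^ (k:ℝ) < F y then (2:ℝ≥0∞) ^ ((k:ℝ) * (P - 1)) else 0))
                * F y := by
                rw [← ENNReal.tsum_mul_right]
                congr 1
                ext k
                simp only [hFk, Set.indicator_apply, Set.mem_ofPred_eq]
                split_ifs <;> simp
            _ ≤ C1 * F y ^ (P - 1) * F y := by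
                gcongr
                exact g1 _
            _ = C1 * F y ^ P := by
                rw [mul_assoc]
                nth_rewrite 2 [← ENNReal.rpow_one (F y)]
                rw [← ENNReal.rpow_add_of_nonneg _ _ (by linarith) (by norm_num)]
                congr 2
                ring
      _ = _ := by
          rw [lintegral_const_mul _ (hF.pow_const P)]
          ring

/-- Lower integrals of (possibly non-measurable) products. -/
lemma prod_lower {E : Type} [MeasurableSpace E] (ν : Measure E) [SigmaFinite ν] (m : ℕ)
    (F : Fin m → E → ℝ≥0∞) (hF : ∀ j x, F j x ≠ ∞) :
    ∫⁻ y, ∏ j, F j (y j) ∂(Measure.pi fun _ : Fin m => ν) ≤ ∏ j, ∫⁻ x, F j x ∂ν := by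
  induction m with
  | zero => simp
  | succ m ih =>
    obtain ⟨h, hm, hle, heq⟩ := exists_measurable_le_lintegral_eq
      (μ := Measure.pi fun _ : Fin (m+1) => ν) (fun y => ∏ j, F j (y j))
    have key : ∀ i : Fin (m+1), ∫⁻ y, ∏ j, F j (y j) ∂(Measure.pi fun _ : Fin (m+1) => ν) =
        ∫⁻ z, h (i.insertNth z.1 z.2) ∂(ν.prod (Measure.pi fun _ : Fin m => ν)) := by
      intro i
      rw [heq]
      have mp := (measurePreserving_piFinSuccAbove (fun _ : Fin (m+1) => ν) i).symm
      rw [← mp.lintegral_comp hm]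
      rfl
    have hmi : ∀ i : Fin (m+1), Measurable (fun z : E × (Fin m → E) =>
        h (i.insertNth (α := fun _ => E) z.1 z.2)) := by
      intro i
      exact hm.comp (MeasurableEquiv.piFinSuccAbove (fun _ : Fin (m+1) => E) i).symm.measurable
    have hb : ∀ (i : Fin (m+1)) (x : E) (y : Fin m → E),
        h (i.insertNth (α := fun _ => E) x y) ≤ F i x * ∏ j, F (i.succAbove j) (y j) := by
      intro i x y
      refine (hle _).trans (le_of_eq ?_)
      simp only
      rw [Fin.prod_univ_succAbove _ i]
      simp
    by_cases hz : ∃ i, ∫⁻ x, F i x ∂ν = 0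
    · obtain ⟨i, hi⟩ := hz
      rw [key i, lintegral_prod_symm _ (hmi i).aemeasurable]
      refine le_trans (le_of_eq ?_) zero_le
      rw [← le_zero_iff]
      calc _ ≤ ∫⁻ y, 0 ∂(Measure.pi fun _ : Fin m => ν) := by
            apply lintegral_mono
            intro y
            simp only
            calc _ ≤ ∫⁻ x, F i x * ∏ j, F (i.succAbove j) (y j) ∂ν :=
                  lintegral_mono (fun x => hb i x y)
              _ = 0 := by
                  rw [lintegral_mul_const' _ _ (ENNReal.prod_ne_top fun j _ => hF _ _), hi,
                    zero_mul]
        _ = 0 := by simp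
    push Not at hz
    by_cases ht : ∃ i, ∫⁻ x, F i x ∂ν = ∞
    · obtain ⟨i, hi⟩ := ht
      rw [Fin.prod_univ_succAbove _ i, hi, ENNReal.top_mul]
      · exact le_top
      · exact Finset.prod_ne_zero_iff.2 fun j _ => hz _
    push Not at ht
    rw [key 0, lintegral_prod _ (hmi 0).aemeasurable, Fin.prod_univ_succAbove _ 0]
    calc _ ≤ ∫⁻ x, F 0 x * ∏ j : Fin m, ∫⁻ x, F ((0 : Fin (m+1)).succAbove j) x ∂ν ∂ν := by
          apply lintegral_mono
          intro x
          simp only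
          calc _ ≤ ∫⁻ y, F 0 x * ∏ j, F ((0 : Fin (m+1)).succAbove j) (y j)
                  ∂(Measure.pi fun _ : Fin m => ν) := lintegral_mono (fun y => hb 0 x y)
            _ ≤ _ := by
                rw [lintegral_const_mul' _ _ (hF _ _)]
                exact mul_le_mul_right (ih _ (fun j x => hF _ _)) _
      _ = _ := by
          rw [lintegral_mul_const' _ _ (ENNReal.prod_ne_top fun j _ => ht _)]

lemma ofReal_two_zpow (k : ℤ) : ENNReal.ofReal ((2:ℝ) ^ k) = (2:ℝ≥0∞) ^ (k:ℝ) := by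
  rw [← Real.rpow_intCast, ← ENNReal.ofReal_rpow_of_pos (by norm_num)]
  simp

lemma potential_bound (m : ℕ) (hm : 0 < m) (hn : 0 < n) (α : ℝ) (hα : α < (m:ℝ) * n)
    (f : Fin m → (Fin n → ℝ) → ℝ) (x : Fin n → ℝ) :
    fracIntegral α f x ≤ 2 ^ ((m:ℝ) * n - α) * ∑' k : ℤ, 2 ^ (-((k:ℝ) * ((m:ℝ) * n - α))) *
      ∏ j, ∫⁻ y in Metric.closedBall x ((2:ℝ) ^ k), ENNReal.ofReal |f j y| := by
  have hm' : Nonempty (Fin m) := ⟨⟨0, hm⟩⟩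
  have hn' : Nonempty (Fin n) := ⟨⟨0, hn⟩⟩
  set e := (m:ℝ) * n - α with he
  have he0 : 0 < e := by linarith
  set X : Fin m → Fin n → ℝ := fun _ => x with hX
  set S : ℤ → Set (Fin m → Fin n → ℝ) :=
    fun k => {y | (2:ℝ) ^ k ≤ dist y X ∧ dist y X < (2:ℝ) ^ (k + 1)} with hS
  have hSm : ∀ k, MeasurableSet (S k) := fun k =>
    (measurableSet_le measurable_const (continuous_id.dist continuous_const).measurable).inter
      (measurableSet_lt (continuous_id.dist continuous_const).measurable measurable_const)
  have hSd : Pairwise (Function.onFun Disjoint S) := by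
    intro a b hab
    rw [Function.onFun, Set.disjoint_left]
    intro y ha hb
    apply hab
    have h1 := (zpow_lt_zpow_iff_right₀ (by norm_num : (1:ℝ) < 2)).1 (ha.1.trans_lt hb.2)
    have h2 := (zpow_lt_zpow_iff_right₀ (by norm_num : (1:ℝ) < 2)).1 (hb.1.trans_lt ha.2)
    omega
  have hSu : ⋃ k, S k = {X}ᶜ := by
    ext y
    simp only [Set.mem_iUnion, Set.mem_compl_iff, Set.mem_singleton_iff]
    constructor
    · rintro ⟨k, hk⟩ rfl
      have := hk.1
      rw [dist_self] at this
      exact absurd this (not_le.2 (by positivity))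
    · intro h
      obtain ⟨k, hk⟩ := exists_mem_Ico_zpow (dist_pos.2 h) (by norm_num : (1:ℝ) < 2)
      exact ⟨k, hk⟩
  have step : ∀ k : ℤ, ∫⁻ y in S k, (∏ j, ENNReal.ofReal |f j (y j)|) /
      ENNReal.ofReal ((∑ j, Real.sqrt (∑ i, (x i - y j i) ^ 2)) ^ e) ≤
      2 ^ (-((k:ℝ) * e)) *
        ∏ j, ∫⁻ y in Metric.closedBall x ((2:ℝ) ^ (k + 1)), ENNReal.ofReal |f j y| := by
    intro k
    calc _ ≤ ∫⁻ y in S k, 2 ^ (-((k:ℝ) * e)) * (∏ j, ENNReal.ofReal |f j (y j)|) := by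
          apply setLIntegral_mono' (hSm k)
          intro y hy
          rw [mul_comm, div_eq_mul_inv]
          gcongr
          rw [ENNReal.rpow_neg, ENNReal.inv_le_inv, ENNReal.rpow_mul, ← ofReal_two_zpow,
            ENNReal.ofReal_rpow_of_pos (by positivity)]
          apply ENNReal.ofReal_le_ofReal
          apply Real.rpow_le_rpow (by positivity) _ he0.le
          refine hy.1.trans ?_
          rw [dist_pi_le_iff (by positivity)]
          intro j
          refine le_trans ?_ (Finset.single_le_sum (f := fun j => Real.sqrt (∑ i, (x i - y j i) ^ 2))
            (fun j _ => Real.sqrt_nonneg _) (Finset.mem_univ j))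
          rw [dist_pi_le_iff (by positivity)]
          intro i
          apply Real.le_sqrt_of_sq_le
          rw [Real.dist_eq, sq_abs]
          refine le_trans (le_of_eq ?_) (Finset.single_le_sum (f := fun i => (x i - y j i) ^ 2)
            (fun i _ => sq_nonneg _) (Finset.mem_univ i))
          simp only [hX]
          ring
      _ = 2 ^ (-((k:ℝ) * e)) * ∫⁻ y in S k, (∏ j, ENNReal.ofReal |f j (y j)|) :=
          lintegral_const_mul' _ _ (two_rpow_ne_top _)
      _ ≤ 2 ^ (-((k:ℝ) * e)) * ∫⁻ y in Set.univ.pi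
            (fun _ : Fin m => Metric.closedBall x ((2:ℝ) ^ (k + 1))),
            (∏ j, ENNReal.ofReal |f j (y j)|) := by
          refine mul_le_mul_right (lintegral_mono_set ?_) _
          intro y hy j _
          rw [Metric.mem_closedBall]
          exact (dist_le_pi_dist y X j).trans hy.2.le
      _ ≤ _ := by
          refine mul_le_mul_right ?_ _
          rw [volume_pi, Measure.restrict_pi_pi]
          exact prod_lower (E := Fin n → ℝ) _ m (fun j y => ENNReal.ofReal |f j y|) (fun _ _ => by simp)
  have hnull : ∫⁻ y : Fin m → Fin n → ℝ, (∏ j, ENNReal.ofReal |f j (y j)|) /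
      ENNReal.ofReal ((∑ j, Real.sqrt (∑ i, (x i - y j i) ^ 2)) ^ e) =
      ∫⁻ y in ⋃ k, S k, (∏ j, ENNReal.ofReal |f j (y j)|) /
      ENNReal.ofReal ((∑ j, Real.sqrt (∑ i, (x i - y j i) ^ 2)) ^ e) := by
    have : Nontrivial (Fin m → Fin n → ℝ) := inferInstance
    rw [hSu, ← lintegral_add_compl _ (measurableSet_singleton X),
      setLIntegral_measure_zero _ _ (measure_singleton X), zero_add]
  rw [fracIntegral, ← he, hnull, lintegral_iUnion hSm hSd]
  refine (ENNReal.tsum_le_tsum step).trans ?_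
  rw [← ENNReal.tsum_mul_left]
  rw [← (Equiv.addRight (1:ℤ)).tsum_eq (fun k : ℤ => 2 ^ e * (2 ^ (-((k:ℝ) * e)) *
      ∏ j, ∫⁻ y in Metric.closedBall x ((2:ℝ) ^ k), ENNReal.ofReal |f j y|))]
  apply ENNReal.tsum_le_tsum
  intro k
  simp only [Equiv.coe_addRight]
  rw [← mul_assoc, ← two_rpow_add]
  apply le_of_eq
  congr 2
  push_cast
  ring

lemma prod_rpow_sum {ι : Type} (t : Finset ι) (D : ℝ≥0∞) (w : ι → ℝ) (hw : ∀ i ∈ t, 0 ≤ w i) :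
    ∏ i ∈ t, D ^ w i = D ^ (∑ i ∈ t, w i) := by
  classical
  induction t using Finset.induction with
  | empty => simp
  | insert a t ha ih =>
    rw [Finset.prod_insert ha, Finset.sum_insert ha,
      ih (fun i hi => hw i (Finset.mem_insert_of_mem hi)),
      ENNReal.rpow_add_of_nonneg _ _ (hw a (Finset.mem_insert_self _ _))
        (Finset.sum_nonneg fun i hi => hw i (Finset.mem_insert_of_mem hi))]

lemma holder_set (P : ℝ) (hP : 1 < P) (F : (Fin n → ℝ) → ℝ≥0∞) (hF : Measurable F)
    (Q : Set (Fin n → ℝ)) :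
    ∫⁻ y in Q, F y ≤ (∫⁻ y in Q, F y ^ P) ^ (1 / P) * volume Q ^ (1 - 1 / P) := by
  have hc := Real.HolderConjugate.conjExponent hP
  have := ENNReal.lintegral_mul_le_Lp_mul_Lq (volume.restrict Q) hc hF.aemeasurable
    (g := fun _ => 1) aemeasurable_const
  simp only [Pi.mul_apply, mul_one, ENNReal.one_rpow, lintegral_const, one_mul,
    Measure.restrict_apply_univ] at this
  refine this.trans (le_of_eq ?_)
  congr 2
  have := hc.inv_add_inv_eq_one
  rw [one_div, one_div]
  linarith

lemma morrey_bound (m : ℕ) (P : Fin m → ℝ) (hP : ∀ j, 1 < P j) (p p0 : ℝ)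
    (hp : 1 / p = ∑ j, 1 / P j) (M : ℝ≥0∞)
    (F : Fin m → (Fin n → ℝ) → ℝ≥0∞) (hF : ∀ j, Measurable (F j))
    (hM : ∀ a r, 0 < r → ∏ j, (∫⁻ x in cube a r, F j x ^ P j) ^ (1 / P j) ≤
      M * ENNReal.ofReal r ^ ((n:ℝ) / p - n / p0))
    (x : Fin n → ℝ) (r : ℝ) (hr : 0 < r) :
    ∏ j, ∫⁻ y in Metric.closedBall x r, F j y ≤
      ENNReal.ofReal 3 ^ ((m:ℝ) * n - n / p0) * M * ENNReal.ofReal r ^ ((m:ℝ) * n - n / p0) := by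
  set Q := cube (fun i => x i - r) (3 * r) with hQ
  have h3r : 0 < 3 * r := by positivity
  calc _ ≤ ∏ j, ((∫⁻ y in Q, F j y ^ P j) ^ (1 / P j) *
        ENNReal.ofReal (3 * r) ^ ((n:ℝ) * (1 - 1 / P j))) := by
        refine Finset.prod_le_prod' fun j _ => ?_
        refine (lintegral_mono_set (closedBall_subset_cube x hr)).trans ?_
        refine (holder_set (P j) (hP j) (F j) (hF j) _).trans (le_of_eq ?_)
        rw [volume_cube, ← ENNReal.rpow_mul]
    _ = (∏ j, (∫⁻ y in Q, F j y ^ P j) ^ (1 / P j)) *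
        ENNReal.ofReal (3 * r) ^ ((m:ℝ) * n - n / p) := by
        rw [Finset.prod_mul_distrib, prod_rpow_sum]
        · congr 2
          rw [← Finset.mul_sum, Finset.sum_sub_distrib, ← hp]
          simp
          ring
        · intro i _
          have : 1 / P i ≤ 1 := by
            rw [div_le_one (by linarith [hP i])]; exact (hP i).le
          have : 0 ≤ 1 - 1 / P i := by linarith
          positivity
    _ ≤ (M * ENNReal.ofReal (3 * r) ^ ((n:ℝ) / p - n / p0)) *
        ENNReal.ofReal (3 * r) ^ ((m:ℝ) * n - n / p) := by
        gcongr
        exact hM _ _ h3r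
    _ = _ := by
        rw [mul_assoc, ← ofReal_rpow_add h3r,
          show (n:ℝ) / p - n / p0 + (m * n - n / p) = m * n - n / p0 by ring,
          ofReal_mul_rpow (by norm_num) hr]
        ring

lemma maximal_bound (m : ℕ) (P : Fin m → ℝ) (hP : ∀ j, 1 < P j) (p p0 β : ℝ)
    (hp : 1 / p = ∑ j, 1 / P j) (hp1 : 1 < p) (hβ : 0 < β) (hβn : β < n / p0) :
    ∃ C : ℝ≥0∞, C ≠ ∞ ∧ ∀ (D M : ℝ≥0∞) (μ : Measure (Fin n → ℝ))
    (F : Fin m → (Fin n → ℝ) → ℝ≥0∞), (∀ j, Measurable (F j)) →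
    (∀ a r, 0 < r → μ (cube a r) ≤ D * ENNReal.ofReal r ^ ((n:ℝ) - β * p)) →
    (∀ a r, 0 < r → ∏ j, (∫⁻ x in cube a r, F j x ^ P j) ^ (1 / P j) ≤
      M * ENNReal.ofReal r ^ ((n:ℝ) / p - n / p0)) →
    ∀ a L, 0 < L → ∃ G : (Fin n → ℝ) → ℝ≥0∞, Measurable G ∧
      (∀ x ∈ cube a L, ∀ r, 0 < r →
        (ENNReal.ofReal r ^ (β - (m:ℝ) * n) * ∏ j, ∫⁻ y in Metric.closedBall x r, F j y) ^ p
          ≤ G x) ∧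
      ∫⁻ x in cube a L, G x ∂μ ≤ C * D * ENNReal.ofReal L ^ ((n:ℝ) - n * p / p0) * M ^ p := by
  have hp0 : 0 < p := by linarith
  have hPpos : ∀ j, 0 < P j := fun j => by linarith [hP j]
  have hw : ∑ j, p / P j = 1 := by
    have : ∑ j, p / P j = p * ∑ j, 1 / P j := by
      rw [Finset.mul_sum]; congr 1; ext j; ring
    rw [this, ← hp]; field_simp
  have hw0 : ∀ j, 0 ≤ p / P j := fun j => div_nonneg hp0.le (hPpos j).le
  choose C hC hCb using fun j => strong_est (n := n) (β * p) (P j) (by positivity) (hP j)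
  set c3 : ℝ≥0∞ := ENNReal.ofReal 3 ^ ((m:ℝ) * n - n / p0) with hc3
  set c4 : ℝ≥0∞ := ENNReal.ofReal 3 ^ (((n:ℝ) / p - n / p0) * p) with hc4
  refine ⟨c3 ^ p + (∏ j, C j ^ (p / P j)) * c4, ?_, ?_⟩
  · refine ENNReal.add_ne_top.2 ⟨?_, ENNReal.mul_ne_top ?_ ?_⟩
    · exact ENNReal.rpow_ne_top_of_nonneg hp0.le (ofReal_rpow_ne_top (by norm_num) _)
    · exact ENNReal.prod_ne_top fun j _ => ENNReal.rpow_ne_top_of_nonneg (hw0 j) (hC j)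
    · exact ofReal_rpow_ne_top (by norm_num) _
  intro D M μ F hF hD hM a L hL
  set Q := cube (fun i => a i - L) (3 * L) with hQ
  have hQm : MeasurableSet Q := measurableSet_cube _ _
  choose H hHm hH1 hH2 using fun j => hCb j D μ hD (Q.indicator (F j)) ((hF j).indicator hQm) L
  refine ⟨fun x => (c3 * M * ENNReal.ofReal L ^ (β - n / p0)) ^ p + ∏ j, H j x ^ (p / P j),
    ?_, ?_, ?_⟩
  · refine measurable_const.add ?_
    exact Finset.measurable_prod _ fun j _ => (hHm j).pow_const _
  · intro x hx r hr
    rcases le_or_gt r L with hrL | hrL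
    · refine le_trans ?_ le_add_self
      have hsub : Metric.closedBall x r ⊆ Q := by
        intro y hy i
        rw [Metric.mem_closedBall] at hy
        have h1 := (dist_le_pi_dist y x i).trans hy
        rw [Real.dist_eq, abs_le] at h1
        have h2 := hx i
        constructor <;> linarith
      calc _ = ∏ j, (ENNReal.ofReal r ^ (β * p) * (ENNReal.ofReal r ^ (-(n:ℝ)) *
            ∫⁻ y in Metric.closedBall x r, Q.indicator (F j) y) ^ P j) ^ (p / P j) := by
            have e1 : ∀ j, ∫⁻ y in Metric.closedBall x r, Q.indicator (F j) y =
                ∫⁻ y in Metric.closedBall x r, F j y := by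
              intro j
              refine setLIntegral_congr_fun Metric.isClosed_closedBall.measurableSet ?_
              intro y hy
              exact Set.indicator_of_mem (hsub hy) _
            have e2 : ∀ j, (ENNReal.ofReal r ^ (β * p) * (ENNReal.ofReal r ^ (-(n:ℝ)) *
                ∫⁻ y in Metric.closedBall x r, Q.indicator (F j) y) ^ P j) ^ (p / P j) =
                (ENNReal.ofReal r ^ (β * p)) ^ (p / P j) * (ENNReal.ofReal r ^ (-(n:ℝ)) *
                ∫⁻ y in Metric.closedBall x r, F j y) ^ p := by
              intro j
              rw [e1, ENNReal.mul_rpow_of_nonneg _ _ (hw0 j), ← ENNReal.rpow_mul (_ * _),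
                mul_div_cancel₀ _ (hPpos j).ne']
            simp_rw [e2]
            rw [Finset.prod_mul_distrib, prod_rpow_sum _ _ _ (fun j _ => hw0 j), hw,
              ENNReal.rpow_one, ENNReal.prod_rpow_of_nonneg hp0.le, ENNReal.rpow_mul,
              ← ENNReal.mul_rpow_of_nonneg _ _ hp0.le, Finset.prod_mul_distrib,
              Finset.prod_const, ← ENNReal.rpow_natCast, ← ENNReal.rpow_mul, ← mul_assoc,
              ← ofReal_rpow_add hr]
            congr 3
            simp
            ring
        _ ≤ _ := by
            refine Finset.prod_le_prod' fun j _ => ?_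
            exact ENNReal.rpow_le_rpow (hH1 j x r hr hrL) (hw0 j)
    · refine le_trans ?_ le_self_add
      refine ENNReal.rpow_le_rpow ?_ hp0.le
      calc _ ≤ ENNReal.ofReal r ^ (β - (m:ℝ) * n) *
            (c3 * M * ENNReal.ofReal r ^ ((m:ℝ) * n - n / p0)) :=
            mul_le_mul_right (morrey_bound m P hP p p0 hp M F hF hM x r hr) _
        _ = c3 * M * ENNReal.ofReal r ^ (β - n / p0) := by
            rw [show β - n / p0 = (β - (m:ℝ) * n) + ((m:ℝ) * n - n / p0) by ring,
              ofReal_rpow_add hr]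
            ring
        _ ≤ _ := by
            refine mul_le_mul_right ?_ _
            rw [show β - n / p0 = -(n / p0 - β) by ring, ENNReal.rpow_neg, ENNReal.rpow_neg,
              ENNReal.inv_le_inv]
            exact ENNReal.rpow_le_rpow (ENNReal.ofReal_le_ofReal hrL.le) (by linarith)
  · rw [lintegral_add_left measurable_const, lintegral_const, Measure.restrict_apply_univ]
    have b1 : (c3 * M * ENNReal.ofReal L ^ (β - n / p0)) ^ p * μ (cube a L) ≤
        c3 ^ p * (D * ENNReal.ofReal L ^ ((n:ℝ) - n * p / p0) * M ^ p) := by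
      calc _ ≤ (c3 * M * ENNReal.ofReal L ^ (β - n / p0)) ^ p *
            (D * ENNReal.ofReal L ^ ((n:ℝ) - β * p)) := mul_le_mul_right (hD a L hL) _
        _ = _ := by
            rw [ENNReal.mul_rpow_of_nonneg _ _ hp0.le, ENNReal.mul_rpow_of_nonneg _ _ hp0.le,
              show (n:ℝ) - n * p / p0 = (β - n / p0) * p + (n - β * p) by ring,
              ofReal_rpow_add hL, ENNReal.rpow_mul]
            ring
    have b2 : ∫⁻ x in cube a L, ∏ j, H j x ^ (p / P j) ∂μ ≤
        (∏ j, C j ^ (p / P j)) * c4 * (D * ENNReal.ofReal L ^ ((n:ℝ) - n * p / p0) * M ^ p) := by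
      calc _ ≤ ∏ j, (∫⁻ x in cube a L, H j x ∂μ) ^ (p / P j) :=
            ENNReal.lintegral_prod_norm_pow_le _ (fun j _ => (hHm j).aemeasurable) hw
              (fun j _ => hw0 j)
        _ ≤ ∏ j, (C j * D * ∫⁻ x in Q, F j x ^ P j) ^ (p / P j) := by
            refine Finset.prod_le_prod' fun j _ => ENNReal.rpow_le_rpow ?_ (hw0 j)
            refine (setLIntegral_le_lintegral _ _).trans ((hH2 j).trans (le_of_eq ?_))
            congr 1
            rw [← lintegral_indicator hQm]
            refine lintegral_congr fun y => ?_
            by_cases hy : y ∈ Q <;> simp [hy, ENNReal.zero_rpow_of_pos (hPpos j)]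
        _ = (∏ j, C j ^ (p / P j)) * D *
            (∏ j, (∫⁻ x in Q, F j x ^ P j) ^ (1 / P j)) ^ p := by
            have e : ∀ j, (C j * D * ∫⁻ x in Q, F j x ^ P j) ^ (p / P j) =
                C j ^ (p / P j) * D ^ (p / P j) * ((∫⁻ x in Q, F j x ^ P j) ^ (1 / P j)) ^ p := by
              intro j
              rw [ENNReal.mul_rpow_of_nonneg _ _ (hw0 j), ENNReal.mul_rpow_of_nonneg _ _ (hw0 j),
                ← ENNReal.rpow_mul (∫⁻ x in Q, F j x ^ P j)]
              congr 2
              ring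
            simp_rw [e]
            rw [Finset.prod_mul_distrib, Finset.prod_mul_distrib,
              prod_rpow_sum _ _ _ (fun j _ => hw0 j), hw, ENNReal.rpow_one,
              ENNReal.prod_rpow_of_nonneg hp0.le]
        _ ≤ (∏ j, C j ^ (p / P j)) * D *
            (M * ENNReal.ofReal (3 * L) ^ ((n:ℝ) / p - n / p0)) ^ p := by
            refine mul_le_mul_right (ENNReal.rpow_le_rpow (hM _ _ (by positivity)) hp0.le) _
        _ = _ := by
            rw [ENNReal.mul_rpow_of_nonneg _ _ hp0.le, ← ENNReal.rpow_mul,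
              ofReal_mul_rpow (by norm_num) hL, ← hc4,
              show ((n:ℝ) / p - n / p0) * p = (n:ℝ) - n * p / p0 by
                rw [sub_mul, div_mul_cancel₀ _ hp0.ne']; ring]
            ring
    refine (add_le_add b1 b2).trans (le_of_eq ?_)
    ring

theorem statement9 (hn : 0 < n) (m : ℕ) (hm : 0 < m)
    (P : Fin m → ℝ) (hP : ∀ j, 1 < P j) (p p0 α β θ q q0 : ℝ)
    (hp : 1 / p = ∑ j, 1 / P j)
    (hp1 : 1 < p) (hpp0 : p ≤ p0) (hp0n : p0 < n / α)
    (hβ : 0 < β) (hβα : β < α) (hα : α < (m : ℝ) * n)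
    (hθ : θ = (n - β * p0) / (n - α * p0)) (hq : q = θ * p) (hq0 : q0 = θ * p0) :
    ∃ C : ℝ≥0∞, 0 < C ∧ C < ∞ ∧
      ∀ μ : Measure (Fin n → ℝ), IsLocallyFiniteMeasure μ →
        ∀ f : Fin m → (Fin n → ℝ) → ℝ,
          radonMorreyNorm μ q q0 (fracIntegral α f) ≤
            C * measureGrowthNorm μ (n - β * p) ^ (1 / q) *
              prodMorreyNorm P p p0 f := by
  have hαpos : 0 < α := hβ.trans hβα
  have hppos : 0 < p := by linarith
  have hp0pos : 0 < p0 := by linarith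
  have hnpos : (0:ℝ) < n := by exact_mod_cast hn
  have hαp0 : α * p0 < n := by
    rw [lt_div_iff₀ hαpos] at hp0n; linarith
  have hβp0 : β * p0 < α * p0 := by nlinarith
  have hαδ : α < n / p0 := by rw [lt_div_iff₀ hp0pos]; exact hαp0
  have hθ1 : 1 < θ := by
    rw [hθ, lt_div_iff₀ (by linarith)]; linarith
  have hθ0 : 0 < θ := by linarith
  have hσ : ((n:ℝ) / p0 - α) / (n / p0 - β) = 1 / θ := by
    have h1 : (n:ℝ) - β * p0 ≠ 0 := by linarith
    have h2 : (n:ℝ) - α * p0 ≠ 0 := by linarith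
    have h3 : (n:ℝ) / p0 - β ≠ 0 := by linarith
    rw [hθ, one_div_div, div_eq_div_iff h3 h1]
    field_simp
  have hqpos : 0 < q := by rw [hq]; positivity
  have hqp : p ≤ q := by rw [hq]; nlinarith
  obtain ⟨Ch, hCh, hedb⟩ := hedberg α β (n / p0) hβα hαδ
  obtain ⟨Cm, hCm, hmax⟩ := maximal_bound (n := n) m P hP p p0 β hp hp1 hβ (hβα.trans hαδ)
  set e := (m:ℝ) * n - α with he
  set c3 : ℝ≥0∞ := ENNReal.ofReal 3 ^ ((m:ℝ) * n - n / p0) with hc3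
  have hc3t : c3 ≠ ∞ := ofReal_rpow_ne_top (by norm_num) _
  set K : ℝ≥0∞ := (2 ^ e * Ch) ^ q * c3 ^ (q - p) * Cm with hK
  have hKt : K ≠ ∞ := by
    refine ENNReal.mul_ne_top (ENNReal.mul_ne_top ?_ ?_) hCm
    · exact ENNReal.rpow_ne_top_of_nonneg hqpos.le (ENNReal.mul_ne_top (two_rpow_ne_top _) hCh)
    · exact ENNReal.rpow_ne_top_of_nonneg (by linarith) hc3t
  have hKq : K ^ (1 / q) ≠ ∞ := ENNReal.rpow_ne_top_of_nonneg (by positivity) hKt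
  refine ⟨K ^ (1 / q) + 1, by simp, by simpa [lt_top_iff_ne_top] using hKq, ?_⟩
  intro μ _ f
  set D := measureGrowthNorm μ (n - β * p) with hDdef
  set M := prodMorreyNorm P p p0 f with hMdef
  have hD : ∀ a r, 0 < r → μ (cube a r) ≤ D * ENNReal.ofReal r ^ ((n:ℝ) - β * p) := by
    intro a r hr
    rw [← ENNReal.div_le_iff (ofReal_rpow_ne_zero hr _) (ofReal_rpow_ne_top hr _)]
    exact le_iSup_of_le a (le_iSup_of_le r (le_iSup_of_le hr le_rfl))
  choose F hFm hFle hFeq using fun j => exists_measurable_le_forall_setLIntegral_eq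
    (μ := (volume : Measure (Fin n → ℝ))) (fun y => ENNReal.ofReal |f j y|)
  have hM : ∀ a r, 0 < r → ∏ j, (∫⁻ x in cube a r, F j x ^ P j) ^ (1 / P j) ≤
      M * ENNReal.ofReal r ^ ((n:ℝ) / p - n / p0) := by
    intro a r hr
    have h1 : volume (cube a r) ^ (1 / p0 - 1 / p) *
        ∏ j, (∫⁻ x in cube a r, ENNReal.ofReal |f j x| ^ P j) ^ (1 / P j) ≤ M :=
      le_iSup_of_le a (le_iSup_of_le r (le_iSup_of_le hr le_rfl))
    calc _ ≤ ∏ j, (∫⁻ x in cube a r, ENNReal.ofReal |f j x| ^ P j) ^ (1 / P j) := by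
          refine Finset.prod_le_prod' fun j _ => ?_
          have hPj : 0 < P j := by linarith [hP j]
          refine ENNReal.rpow_le_rpow (lintegral_mono fun x => ?_) (by positivity)
          exact ENNReal.rpow_le_rpow (hFle j x) hPj.le
      _ = (volume (cube a r) ^ (1 / p0 - 1 / p) *
          ∏ j, (∫⁻ x in cube a r, ENNReal.ofReal |f j x| ^ P j) ^ (1 / P j)) *
            ENNReal.ofReal r ^ ((n:ℝ) / p - n / p0) := by
          rw [volume_cube, ← ENNReal.rpow_mul, mul_right_comm, ← ofReal_rpow_add hr,
            show (n:ℝ) * (1 / p0 - 1 / p) + (n / p - n / p0) = 0 by ring, ENNReal.rpow_zero,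
            one_mul]
      _ ≤ _ := by gcongr
  refine iSup_le fun a => iSup_le fun L => iSup_le fun hL => ?_
  obtain ⟨G, hGm, hG1, hG2⟩ := hmax D M μ F hFm hD hM a L hL
  have hpt : ∀ x ∈ cube a L, fracIntegral α f x ^ q ≤
      (2 ^ e * Ch) ^ q * (c3 * M) ^ (q - p) * G x := by
    intro x hx
    set b : ℤ → ℝ≥0∞ := fun k => 2 ^ (-((k:ℝ) * ((m:ℝ) * n))) *
      ∏ j, ∫⁻ y in Metric.closedBall x ((2:ℝ) ^ k), F j y with hb
    have h1 : fracIntegral α f x ≤ 2 ^ e * ∑' k : ℤ, 2 ^ ((k:ℝ) * α) * b k := by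
      refine (potential_bound m hm hn α hα f x).trans (le_of_eq ?_)
      congr 2
      ext k
      simp only [hb, hFeq]
      rw [← mul_assoc, ← two_rpow_add]
      congr 2
      ring
    have hbA : ∀ k, b k ≤ 2 ^ (-((k:ℝ) * β)) * G x ^ (1 / p) := by
      intro k
      have h2k : (0:ℝ) < 2 ^ k := by positivity
      have := hG1 x hx ((2:ℝ) ^ k) h2k
      rw [ofReal_two_zpow, ← ENNReal.le_rpow_inv_iff hppos, ← one_div, ← ENNReal.rpow_mul] at this
      calc b k = 2 ^ (-((k:ℝ) * β)) * (2 ^ ((k:ℝ) * (β - (m:ℝ) * n)) *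
            ∏ j, ∫⁻ y in Metric.closedBall x ((2:ℝ) ^ k), F j y) := by
            rw [← mul_assoc, ← two_rpow_add]
            simp only [hb]
            congr 2
            ring
        _ ≤ _ := mul_le_mul_right this _
    have hbM : ∀ k, b k ≤ 2 ^ (-((k:ℝ) * (n / p0))) * (c3 * M) := by
      intro k
      have h2k : (0:ℝ) < 2 ^ k := by positivity
      have := morrey_bound m P hP p p0 hp M F hFm hM x ((2:ℝ) ^ k) h2k
      rw [ofReal_two_zpow, ← ENNReal.rpow_mul] at this
      refine (mul_le_mul_right this _).trans (le_of_eq ?_)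
      rw [mul_comm (ENNReal.ofReal 3 ^ _ * M), ← mul_assoc, ← two_rpow_add]
      congr 2
      ring
    have h2 := hedb _ _ b hbA hbM
    rw [hσ] at h2
    have h3 : fracIntegral α f x ≤
        (2 ^ e * Ch) * ((G x ^ (1 / p)) ^ (1 / θ) * (c3 * M) ^ (1 - 1 / θ)) := by
      rw [mul_assoc]
      exact h1.trans (mul_le_mul_right h2 _)
    refine (ENNReal.rpow_le_rpow h3 hqpos.le).trans (le_of_eq ?_)
    generalize (2 ^ e * Ch : ℝ≥0∞) = B
    generalize c3 * M = N
    rw [ENNReal.mul_rpow_of_nonneg _ _ hqpos.le, ENNReal.mul_rpow_of_nonneg _ _ hqpos.le,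
      ← ENNReal.rpow_mul, ← ENNReal.rpow_mul, ← ENNReal.rpow_mul,
      show 1 / p * (1 / θ * q) = 1 by rw [hq]; field_simp,
      show (1 - 1 / θ) * q = q - p by rw [hq]; field_simp, ENNReal.rpow_one]
    ring
  have hint : ∫⁻ x in cube a L, fracIntegral α f x ^ q ∂μ ≤
      K * D * ENNReal.ofReal L ^ ((n:ℝ) - n * p / p0) * M ^ q := by
    calc _ ≤ ∫⁻ x in cube a L, (2 ^ e * Ch) ^ q * (c3 * M) ^ (q - p) * G x ∂μ :=
          setLIntegral_mono' (measurableSet_cube a L) hpt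
      _ = (2 ^ e * Ch) ^ q * (c3 * M) ^ (q - p) * ∫⁻ x in cube a L, G x ∂μ :=
          lintegral_const_mul _ hGm
      _ ≤ (2 ^ e * Ch) ^ q * (c3 * M) ^ (q - p) *
          (Cm * D * ENNReal.ofReal L ^ ((n:ℝ) - n * p / p0) * M ^ p) := mul_le_mul_right hG2 _
      _ = _ := by
          rw [ENNReal.mul_rpow_of_nonneg _ _ (by linarith : 0 ≤ q - p),
            show M ^ q = M ^ (q - p) * M ^ p by
              rw [← ENNReal.rpow_add_of_nonneg _ _ (by linarith) hppos.le, sub_add_cancel], hK]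
          ring
  have hq' : 0 ≤ 1 / q := by positivity
  calc _ ≤ ENNReal.ofReal L ^ ((n:ℝ) * (1 / q0 - 1 / q)) *
        (K * D * ENNReal.ofReal L ^ ((n:ℝ) - n * p / p0) * M ^ q) ^ (1 / q) := by
        rw [volume_cube, ← ENNReal.rpow_mul]
        exact mul_le_mul_right (ENNReal.rpow_le_rpow hint hq') _
    _ = (ENNReal.ofReal L ^ ((n:ℝ) * (1 / q0 - 1 / q)) *
        ENNReal.ofReal L ^ (((n:ℝ) - n * p / p0) * (1 / q))) *
        (K ^ (1 / q) * D ^ (1 / q) * M) := by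
        rw [ENNReal.mul_rpow_of_nonneg _ _ hq', ENNReal.mul_rpow_of_nonneg _ _ hq',
          ENNReal.mul_rpow_of_nonneg _ _ hq', ← ENNReal.rpow_mul, ← ENNReal.rpow_mul M,
          mul_one_div_cancel hqpos.ne', ENNReal.rpow_one]
        ring
    _ = K ^ (1 / q) * D ^ (1 / q) * M := by
        rw [← ofReal_rpow_add hL,
          show (n:ℝ) * (1 / q0 - 1 / q) + ((n:ℝ) - n * p / p0) * (1 / q) = 0 by
            rw [hq0, hq]; field_simp; ring, ENNReal.rpow_zero, one_mul]
    _ ≤ _ := by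
        gcongr
        exact le_self_add
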